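/- Let F be a finite field with q elements, let m, n, T be positive integers, and set h = min(m,n). Let C_m(n,m,T) denote the capacity of the channel Y = G·X with G uniform over all n×m matrices over F, and let C_fm(n,m,T) denote the capacity of the channel Y = A·X with A chosen uniformly at random among all n×m matrices over F of full rank min(n,m) (in both cases the channel matrix is independent of the input X ∈ F^{m×T}). Then C_m(h,h,T) ≤ C_m(n,m,T) ≤ C_fm(n,m,T) ≤ C_fm(h,h,T). -/

import Mathlib

open Finset

/- Mutual information (in nats) between two finite-valued random variables `U` and `V`
defined on a finite probability space with probability mass function `μ`. -/
open Classical in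
noncomputable def mutualInfo {Ω A B : Type*} [Fintype Ω] (μ : Ω → ℝ) (U : Ω → A) (V : Ω → B) : ℝ :=
  ∑ ω : Ω, μ ω * Real.log
    ((∑ ω' : Ω, if U ω' = U ω ∧ V ω' = V ω then μ ω' else 0) /
     ((∑ ω' : Ω, if U ω' = U ω then μ ω' else 0) * (∑ ω' : Ω, if V ω' = V ω then μ ω' else 0)))

/- The capacity of the non-coherent matrix channel `Y = G·X`, where the input `X` ranges
over `F^{m×T}` with an arbitrary pmf `p` and `G` is uniform on `F^{n×m}`, independent of `X`:
the supremum, over input distributions, of the mutual information `I(X;Y)`. -/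
noncomputable def capacityM (F : Type) [Field F] [Fintype F] (n m T : ℕ) : ℝ :=
  sSup { I : ℝ | ∃ p : Matrix (Fin m) (Fin T) F → ℝ,
    (∀ x, 0 ≤ p x) ∧ (∑ x, p x = 1) ∧
    I = mutualInfo
        (fun ω : Matrix (Fin m) (Fin T) F × Matrix (Fin n) (Fin m) F =>
          p ω.1 / (Fintype.card (Matrix (Fin n) (Fin m) F) : ℝ))
        (fun ω => ω.1) (fun ω => ω.2 * ω.1) }

/- The capacity of the channel `Y = A·X` where the channel matrix `A` is uniform over the
full-rank matrices in `F^{n×m}` (rank equal to `min n m`), independent of the input `X`. -/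
open Classical in
noncomputable def capacityFM (F : Type) [Field F] [Fintype F] (n m T : ℕ) : ℝ :=
  sSup { I : ℝ | ∃ p : Matrix (Fin m) (Fin T) F → ℝ,
    (∀ x, 0 ≤ p x) ∧ (∑ x, p x = 1) ∧
    I = mutualInfo
        (fun ω : Matrix (Fin m) (Fin T) F × {A : Matrix (Fin n) (Fin m) F // A.rank = min n m} =>
          p ω.1 / (Nat.card {A : Matrix (Fin n) (Fin m) F // A.rank = min n m} : ℝ))
        (fun ω => ω.1) (fun ω => (ω.2 : Matrix (Fin n) (Fin m) F) * ω.1) }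


namespace CapAux

lemma log_sum {ι : Type*} (s : Finset ι) (a b : ι → ℝ) (ha : ∀ i, 0 ≤ a i) (hb : ∀ i, 0 ≤ b i)
    (hab : ∀ i, b i = 0 → a i = 0) :
    (∑ i ∈ s, a i) * Real.log ((∑ i ∈ s, a i) / (∑ i ∈ s, b i)) ≤
      ∑ i ∈ s, a i * Real.log (a i / b i) := by
  set A := ∑ i ∈ s, a i with hA
  set B := ∑ i ∈ s, b i with hB
  have hA0 : 0 ≤ A := Finset.sum_nonneg fun i _ => ha i
  have hB0 : 0 ≤ B := Finset.sum_nonneg fun i _ => hb i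
  rcases hA0.eq_or_lt with h | hApos
  · rw [← h, zero_mul]
    have : ∀ i ∈ s, a i = 0 := (Finset.sum_eq_zero_iff_of_nonneg (fun i _ => ha i)).1 h.symm
    exact (Finset.sum_eq_zero fun i hi => by rw [this i hi, zero_mul]).ge
  have hBpos : 0 < B := by
    rcases hB0.eq_or_lt with h | h
    · have : ∀ i ∈ s, b i = 0 := (Finset.sum_eq_zero_iff_of_nonneg (fun i _ => hb i)).1 h.symm
      have : A = 0 := Finset.sum_eq_zero fun i hi => hab i (this i hi)
      linarith
    · exact h
  have key : ∀ i, a i * Real.log (A / B) - a i * Real.log (a i / b i) ≤ A / B * b i - a i := by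
    intro i
    rcases (ha i).eq_or_lt with h | h
    · rw [← h]; simp; have := hb i; positivity
    · have hbi : 0 < b i := lt_of_le_of_ne (hb i) fun h0 => by
        have := hab i h0.symm; linarith
      have h1 : Real.log (A / B) - Real.log (a i / b i) = Real.log (A / B / (a i / b i)) :=
        (Real.log_div (by positivity) (by positivity)).symm
      have h2 := Real.log_le_sub_one_of_pos (x := A / B / (a i / b i)) (by positivity)
      calc _ = a i * Real.log (A / B / (a i / b i)) := by rw [← h1]; ring
        _ ≤ a i * (A / B / (a i / b i) - 1) := mul_le_mul_of_nonneg_left h2 h.le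
        _ = _ := by field_simp
  have := Finset.sum_le_sum fun i (_ : i ∈ s) => key i
  rw [Finset.sum_sub_distrib, Finset.sum_sub_distrib, ← Finset.sum_mul, ← Finset.mul_sum,
    ← hA, ← hB, div_mul_cancel₀ _ hBpos.ne'] at this
  linarith

open Classical in
noncomputable def CW {X Y G : Type*} [Fintype G] (act : G → X → Y) (x : X) (y : Y) : ℝ :=
  (∑ a : G, if act a x = y then (1 : ℝ) else 0) / Nat.card G

noncomputable def MI {X Y : Type*} [Fintype X] [Fintype Y] (p : X → ℝ) (W : X → Y → ℝ) : ℝ :=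
  ∑ x, p x * ∑ y, W x y * Real.log (W x y / ∑ x', p x' * W x' y)

lemma CW_nonneg {X Y G : Type*} [Fintype G] (act : G → X → Y) (x : X) (y : Y) : 0 ≤ CW act x y := by
  classical
  unfold CW
  refine div_nonneg (Finset.sum_nonneg fun i _ => ?_) (by positivity)
  split_ifs <;> norm_num

lemma CW_le_one {X Y G : Type*} [Fintype G] [Nonempty G] (act : G → X → Y) (x : X) (y : Y) :
    CW act x y ≤ 1 := by
  classical
  unfold CW
  rw [div_le_one (by exact_mod_cast Nat.card_pos), Nat.card_eq_fintype_card]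
  calc _ ≤ ∑ a : G, (1 : ℝ) := Finset.sum_le_sum fun i _ => by split_ifs <;> norm_num
    _ = _ := by simp

lemma sum_CW {X Y G : Type*} [Fintype G] [Fintype Y] (act : G → X → Y) (x : X) (f : Y → ℝ) :
    ∑ y, CW act x y * f y = ∑ a : G, f (act a x) / Nat.card G := by
  classical
  unfold CW
  simp_rw [div_mul_eq_mul_div, Finset.sum_mul, ← Finset.sum_div]
  rw [Finset.sum_comm]
  congr 1
  refine Finset.sum_congr rfl fun a _ => ?_
  simp

lemma mutualInfo_eq {X Y G : Type*} [Fintype X] [Fintype Y] [Fintype G] [Nonempty G]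
    (act : G → X → Y) (p : X → ℝ) :
    mutualInfo (fun ω : X × G => p ω.1 / (Nat.card G : ℝ)) (fun ω => ω.1) (fun ω => act ω.2 ω.1)
     = MI p (CW act) := by
  classical
  have hN : (Nat.card G : ℝ) ≠ 0 := by exact_mod_cast Nat.card_pos.ne'
  unfold mutualInfo MI
  rw [Fintype.sum_prod_type]
  refine Finset.sum_congr rfl fun x _ => ?_
  rw [sum_CW act x (fun y => Real.log (CW act x y / ∑ x', p x' * CW act x' y)), Finset.mul_sum]
  refine Finset.sum_congr rfl fun a _ => ?_
  by_cases hp : p x = 0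
  · simp [hp]
  have h1 : (∑ ω' : X × G, if ω'.1 = x ∧ act ω'.2 ω'.1 = act a x then p ω'.1 / (Nat.card G : ℝ) else 0)
      = p x * CW act x (act a x) := by
    rw [Fintype.sum_prod_type, Finset.sum_eq_single x]
    · unfold CW
      rw [← mul_div_assoc, Finset.mul_sum, Finset.sum_div]
      refine Finset.sum_congr rfl fun b _ => ?_
      by_cases h : act b x = act a x <;> simp [h]
    · intro b _ hb
      simp [hb]
    · simp
  have h2 : (∑ ω' : X × G, if ω'.1 = x then p ω'.1 / (Nat.card G : ℝ) else 0) = p x := by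
    rw [Fintype.sum_prod_type, Finset.sum_eq_single x]
    · simp [← Nat.card_eq_fintype_card]; field_simp
    · intro b _ hb
      simp [hb]
    · simp
  have h3 : (∑ ω' : X × G, if act ω'.2 ω'.1 = act a x then p ω'.1 / (Nat.card G : ℝ) else 0)
      = ∑ x', p x' * CW act x' (act a x) := by
    rw [Fintype.sum_prod_type]
    refine Finset.sum_congr rfl fun x' _ => ?_
    unfold CW
    rw [← mul_div_assoc, Finset.mul_sum, Finset.sum_div]
    refine Finset.sum_congr rfl fun b _ => ?_
    by_cases h : act b x' = act a x <;> simp [h]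
  simp only [] at *
  rw [h1, h2, h3, mul_div_mul_left _ _ hp]
  ring

lemma MI_le {X Y G : Type*} [Fintype X] [Fintype Y] [Fintype G] [Nonempty G]
    (act : G → X → Y) (p : X → ℝ) (hp : ∀ x, 0 ≤ p x) :
    MI p (CW act) ≤ Fintype.card X * Fintype.card Y := by
  unfold MI
  have : ∀ x y, p x * (CW act x y * Real.log (CW act x y / ∑ x', p x' * CW act x' y)) ≤ 1 := by
    intro x y
    rcases (hp x).eq_or_lt with h | h
    · rw [← h]; simp
    rcases (CW_nonneg act x y).eq_or_lt with h' | h'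
    · rw [← h']; simp
    have hq : p x * CW act x y ≤ ∑ x', p x' * CW act x' y :=
      Finset.single_le_sum (f := fun x' => p x' * CW act x' y)
        (fun i _ => mul_nonneg (hp i) (CW_nonneg act i y)) (Finset.mem_univ x)
    have hpw : 0 < p x * CW act x y := mul_pos h h'
    have h1 : CW act x y / ∑ x', p x' * CW act x' y ≤ 1 / p x := by
      rw [div_le_div_iff₀ (by linarith) h]; linarith
    have h2 : Real.log (CW act x y / ∑ x', p x' * CW act x' y) ≤ 1 / p x := by
      refine (Real.log_le_sub_one_of_pos (div_pos h' (by linarith))).trans (by linarith)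
    calc _ = (p x * CW act x y) * Real.log (CW act x y / ∑ x', p x' * CW act x' y) := by ring
      _ ≤ (p x * CW act x y) * (1 / p x) := mul_le_mul_of_nonneg_left h2 hpw.le
      _ = CW act x y := by field_simp
      _ ≤ 1 := CW_le_one act x y
  calc _ = ∑ x, ∑ y, p x * (CW act x y * Real.log (CW act x y / ∑ x', p x' * CW act x' y)) := by
        simp_rw [Finset.mul_sum]
    _ ≤ ∑ x : X, ∑ y : Y, (1 : ℝ) := Finset.sum_le_sum fun x _ => Finset.sum_le_sum fun y _ => this x y
    _ = _ := by simp

noncomputable def cap {X Y G : Type*} [Fintype X] [Fintype G] (act : G → X → Y) : ℝ :=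
  sSup { I : ℝ | ∃ p : X → ℝ, (∀ x, 0 ≤ p x) ∧ (∑ x, p x = 1) ∧
    I = mutualInfo (fun ω : X × G => p ω.1 / (Nat.card G : ℝ)) (fun ω => ω.1)
      (fun ω => act ω.2 ω.1) }

lemma le_cap {X Y G : Type*} [Fintype X] [Fintype Y] [Fintype G] [Nonempty G]
    (act : G → X → Y) (p : X → ℝ) (hp : ∀ x, 0 ≤ p x) (hp1 : ∑ x, p x = 1) :
    MI p (CW act) ≤ cap act := by
  refine le_csSup ⟨Fintype.card X * Fintype.card Y, ?_⟩ ⟨p, hp, hp1, (mutualInfo_eq act p).symm⟩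
  rintro _ ⟨p, hp, hp1, rfl⟩
  rw [mutualInfo_eq]
  exact MI_le act p hp

/-- data processing with shared randomness -/
lemma dp {X Y X' Y' S : Type*} [Fintype X] [Fintype Y] [Fintype X'] [Fintype Y'] [Fintype S]
    [Nonempty S] (W : X → Y → ℝ) (hW : ∀ x y, 0 ≤ W x y) (W' : X' → Y' → ℝ)
    (e : S → X' → X) (d : S → Y → Y')
    (hW' : ∀ x y', W' x y' = (∑ s, ∑ y, (open Classical in if d s y = y' then W (e s x) y else 0)) / Nat.card S)
    (p : X' → ℝ) (hp : ∀ x, 0 ≤ p x) (C : ℝ)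
    (hC : ∀ s, MI (fun x => ∑ x', (open Classical in if e s x' = x then p x' else 0)) W ≤ C) :
    MI p W' ≤ C := by
  classical
  set N : ℝ := (Nat.card S : ℝ) with hNdef
  have hN : 0 < N := by simp only [hNdef]; exact_mod_cast Nat.card_pos
  -- inner quantity
  let a : X' → S × Y → ℝ := fun x z => W (e z.1 x) z.2
  let b : S × Y → ℝ := fun z => ∑ x', p x' * W (e z.1 x') z.2
  have hmi : ∀ s, MI (fun x => ∑ x', if e s x' = x then p x' else 0) W =
      ∑ x, p x * ∑ y, a x (s, y) * Real.log (a x (s, y) / b (s, y)) := by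
    intro s
    have push : ∀ f : X → ℝ, ∑ x, (∑ x', if e s x' = x then p x' else 0) * f x = ∑ x', p x' * f (e s x') := by
      intro f
      simp_rw [Finset.sum_mul]
      rw [Finset.sum_comm]
      refine Finset.sum_congr rfl fun x' _ => ?_
      simp
    unfold MI
    rw [push]
    simp_rw [push (fun x => W x _)]
    rfl
  have hfil : ∀ x y', W' x y' = (∑ z ∈ Finset.univ.filter (fun z : S × Y => d z.1 z.2 = y'), a x z) / N := by
    intro x y'
    rw [hW', Finset.sum_filter, Fintype.sum_prod_type]
  have hq : ∀ y', ∑ x', p x' * W' x' y' =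
      (∑ z ∈ Finset.univ.filter (fun z : S × Y => d z.1 z.2 = y'), b z) / N := by
    intro y'
    simp_rw [hfil, ← mul_div_assoc, ← Finset.sum_div, Finset.mul_sum]
    rw [Finset.sum_comm]
  have main : ∀ x, p x * ∑ y', W' x y' * Real.log (W' x y' / ∑ x', p x' * W' x' y') ≤
      p x * ((∑ s, ∑ y, a x (s, y) * Real.log (a x (s, y) / b (s, y))) / N) := by
    intro x
    rcases (hp x).eq_or_lt with h | h
    · rw [← h]; simp
    refine mul_le_mul_of_nonneg_left ?_ h.le
    rw [← Fintype.sum_prod_type (f := fun z : S × Y => a x z * Real.log (a x z / b z)),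
      ← Finset.sum_fiberwise (s := Finset.univ) (g := fun z : S × Y => d z.1 z.2), Finset.sum_div]
    refine Finset.sum_le_sum fun y' _ => ?_
    rw [hq, hfil, div_div_div_cancel_right₀ hN.ne', div_mul_eq_mul_div]
    refine div_le_div_of_nonneg_right ?_ hN.le
    refine log_sum _ _ _ (fun z => hW _ _)
      (fun z => Finset.sum_nonneg fun x' _ => mul_nonneg (hp _) (hW _ _)) ?_
    intro z hz
    have := (Finset.sum_eq_zero_iff_of_nonneg
      (fun x' _ => mul_nonneg (hp x') (hW (e z.1 x') z.2))).1 hz x (Finset.mem_univ x)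
    exact (mul_eq_zero.1 this).resolve_left h.ne'
  calc MI p W' ≤ ∑ x, p x * ((∑ s, ∑ y, a x (s, y) * Real.log (a x (s, y) / b (s, y))) / N) :=
        Finset.sum_le_sum fun x _ => main x
    _ = (∑ s, MI (fun x => ∑ x', if e s x' = x then p x' else 0) W) / N := by
        simp_rw [hmi, ← mul_div_assoc, ← Finset.sum_div, Finset.mul_sum]
        rw [Finset.sum_comm]
    _ ≤ (∑ s : S, C) / N := div_le_div_of_nonneg_right (Finset.sum_le_sum fun s _ => hC s) hN.le
    _ = C := by
        simp [hNdef]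

def Unif {Z A : Type*} (f : Z → A) : Prop :=
  ∀ b b', ∃ φ : Z → Z, Function.Injective φ ∧ ∀ z, f z = b → f (φ z) = b'

lemma unif_count {Z A : Type*} [Fintype Z] [Fintype A] [Nonempty Z] (f : Z → A) (h : Unif f) (F : A → ℝ) :
    (∑ z, F (f z)) / Nat.card Z = (∑ a, F a) / Nat.card A := by
  classical
  have hle : ∀ b b', (Finset.univ.filter fun z => f z = b).card ≤ (Finset.univ.filter fun z => f z = b').card := by
    intro b b'
    obtain ⟨φ, hφ, h2⟩ := h b b'
    refine Finset.card_le_card_of_injOn φ ?_ hφ.injOn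
    intro z hz
    simp at hz ⊢
    exact h2 z hz
  obtain ⟨z0⟩ := ‹Nonempty Z›
  set c := (Finset.univ.filter fun z => f z = f z0).card with hc
  have hcc : ∀ b, (Finset.univ.filter fun z => f z = b).card = c := fun b => le_antisymm (hle _ _) (hle _ _)
  have hs : ∀ F : A → ℝ, ∑ z, F (f z) = c * ∑ a, F a := by
    intro F
    rw [← Finset.sum_fiberwise (s := Finset.univ) (g := f), Finset.mul_sum]
    refine Finset.sum_congr rfl fun a _ => ?_
    rw [← hcc a, ← nsmul_eq_mul, ← Finset.sum_const]
    refine Finset.sum_congr rfl fun z hz => ?_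
    rw [(Finset.mem_filter.1 hz).2]
  have h1 := hs (fun _ => 1)
  have hc0 : (c : ℝ) ≠ 0 := by
    have : 0 < c := Finset.card_pos.2 ⟨z0, by simp⟩
    positivity
  simp at h1
  rw [hs, Nat.card_eq_fintype_card, Nat.card_eq_fintype_card, h1, mul_div_mul_left _ _ hc0]

lemma cap_le {X Y G X' Y' G' S Z : Type*} [Fintype X] [Fintype Y] [Fintype X'] [Fintype Y']
    [Fintype G] [Fintype G'] [Fintype S] [Fintype Z] [Nonempty Z] [Nonempty X']
    (act : G → X → Y) (act' : G' → X' → Y') (e : S → X' → X) (d : S → Y → Y')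
    (σ : Z → S) (α : Z → G) (β : Z → G') (h1 : Unif fun z => (σ z, α z)) (h2 : Unif β)
    (hact : ∀ z x, act' (β z) x = d (σ z) (act (α z) (e (σ z) x))) :
    cap act' ≤ cap act := by
  classical
  obtain ⟨z0⟩ := id ‹Nonempty Z›
  have : Nonempty S := ⟨σ z0⟩
  have : Nonempty G := ⟨α z0⟩
  have : Nonempty G' := ⟨β z0⟩
  refine csSup_le ?_ ?_
  · obtain ⟨x0⟩ := id ‹Nonempty X'›
    exact ⟨_, fun x => if x = x0 then 1 else 0, fun x => by dsimp only; split_ifs <;> norm_num, by simp, rfl⟩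
  rintro _ ⟨p, hp, hp1, rfl⟩
  rw [mutualInfo_eq]
  refine dp (CW act) (CW_nonneg act) _ e d ?_ p hp _ ?_
  · intro x y'
    have e1 := unif_count β h2 (fun a => if act' a x = y' then (1:ℝ) else 0)
    have e2 := unif_count _ h1 (fun sa : S × G => if d sa.1 (act sa.2 (e sa.1 x)) = y' then (1:ℝ) else 0)
    simp only [hact] at e1
    have e3 : CW act' x y' = (∑ a, if act' a x = y' then (1:ℝ) else 0) / Nat.card G' := rfl
    rw [e3, ← e1, e2, Fintype.sum_prod_type, Nat.card_prod, Nat.cast_mul, mul_comm, ← div_div, Finset.sum_div]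
    congr 1
    refine Finset.sum_congr rfl fun s _ => ?_
    have := sum_CW act (e s x) (fun y => if d s y = y' then (1:ℝ) else 0)
    simp only [mul_ite, mul_one, mul_zero] at this
    rw [Finset.sum_div, ← this]
  · intro s
    refine le_cap act _ (fun x => Finset.sum_nonneg fun x' _ => ?_) ?_
    · split_ifs
      · exact hp _
      · exact le_rfl
    · rw [Finset.sum_comm]
      simpa using hp1

end CapAux

namespace CapAux

lemma inj_of_rank {F : Type*} [Field F] {n m : ℕ} (A : Matrix (Fin n) (Fin m) F) (h : A.rank = m) :
    Function.Injective A.mulVecLin := by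
  rw [← LinearMap.ker_eq_bot, ← Submodule.finrank_eq_zero (R := F)]
  have := A.mulVecLin.finrank_range_add_finrank_ker
  simp only [Module.finrank_fin_fun] at this
  unfold Matrix.rank at h
  omega

lemma rank_of_inj {F : Type*} [Field F] {n m : ℕ} (A : Matrix (Fin n) (Fin m) F)
    (h : Function.Injective A.mulVecLin) : A.rank = m := by
  unfold Matrix.rank
  rw [LinearMap.finrank_range_of_inj h]; simp

def unitOf {F : Type*} [Field F] {n : ℕ} (g : (Fin n → F) ≃ₗ[F] (Fin n → F)) :
    (Matrix (Fin n) (Fin n) F)ˣ where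
  val := LinearMap.toMatrix' g.toLinearMap
  inv := LinearMap.toMatrix' g.symm.toLinearMap
  val_inv := by rw [← LinearMap.toMatrix'_comp]; simp
  inv_val := by rw [← LinearMap.toMatrix'_comp]; simp

lemma L2 {F : Type*} [Field F] {n m : ℕ} (A A' : Matrix (Fin n) (Fin m) F)
    (h : A.rank = m) (h' : A'.rank = m) :
    ∃ Q : (Matrix (Fin n) (Fin n) F)ˣ, A' = (Q : Matrix (Fin n) (Fin n) F) * A := by
  have i := inj_of_rank A h
  have i' := inj_of_rank A' h'
  obtain ⟨g, hg⟩ := Submodule.exists_linearEquiv_restrict_eq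
    ((LinearEquiv.ofInjective _ i).symm ≪≫ₗ (LinearEquiv.ofInjective _ i'))
  refine ⟨unitOf g, ?_⟩
  apply Matrix.toLin'.injective
  rw [Matrix.toLin'_mul]
  simp only [unitOf, Matrix.toLin'_toMatrix']
  refine LinearMap.ext fun x => ?_
  have := hg (LinearEquiv.ofInjective _ i x)
  simpa using this

lemma L2' {F : Type*} [Field F] {n m : ℕ} (A A' : Matrix (Fin n) (Fin m) F)
    (h : A.rank = n) (h' : A'.rank = n) :
    ∃ Q : (Matrix (Fin m) (Fin m) F)ˣ, A' = A * (Q : Matrix (Fin m) (Fin m) F) := by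
  obtain ⟨Q, hQ⟩ := L2 A.transpose A'.transpose (by rwa [Matrix.rank_transpose]) (by rwa [Matrix.rank_transpose])
  refine ⟨⟨(Q : Matrix _ _ F).transpose, ((Q⁻¹ : _ˣ) : Matrix _ _ F).transpose, ?_, ?_⟩, ?_⟩
  · rw [← Matrix.transpose_mul, ← Units.val_mul]; simp
  · rw [← Matrix.transpose_mul, ← Units.val_mul]; simp
  · rw [← Matrix.transpose_transpose A', hQ, Matrix.transpose_mul]; simp

lemma L3 {F : Type*} [Field F] {n m : ℕ} (hmn : m ≤ n) (G : Matrix (Fin n) (Fin m) F) :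
    ∃ (A : Matrix (Fin n) (Fin m) F) (B : Matrix (Fin m) (Fin m) F), A.rank = m ∧ G = A * B := by
  obtain ⟨ι, hι⟩ : ∃ ι : (Fin m → F) →ₗ[F] (Fin n → F), Function.Injective ι := by
    rw [← finrank_le_iff_exists_linearMap (R := F)]; simpa using hmn
  obtain ⟨C, hC⟩ := (LinearMap.ker G.mulVecLin).exists_isCompl
  obtain ⟨g, hg⟩ := Submodule.exists_linearEquiv_restrict_eq
    ((Submodule.equivMapOfInjective ι hι C).symm ≪≫ₗ LinearMap.kerComplementEquivRange _ hC.symm)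
  let π := C.subtype ∘ₗ C.projectionOnto _ hC.symm
  have hA : Matrix.mulVecLin (LinearMap.toMatrix' (g.toLinearMap ∘ₗ ι)) = g.toLinearMap ∘ₗ ι := by
    rw [← Matrix.toLin'_apply', Matrix.toLin'_toMatrix']
  refine ⟨LinearMap.toMatrix' (g.toLinearMap ∘ₗ ι), LinearMap.toMatrix' π, ?_, ?_⟩
  · apply rank_of_inj
    rw [hA]
    exact g.injective.comp hι
  · rw [← LinearMap.toMatrix'_comp]
    apply Matrix.toLin'.injective
    rw [Matrix.toLin'_toMatrix']
    refine LinearMap.ext fun x => ?_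
    have := hg (Submodule.equivMapOfInjective ι hι C (C.projectionOnto _ hC.symm x))
    obtain ⟨y, z, hy, hz, rfl⟩ := Submodule.codisjoint_iff_exists_add_eq.mp hC.symm.codisjoint x
    have h1 : C.projectionOnto _ hC.symm (y + z) = ⟨y, hy⟩ := by
      rw [map_add, Submodule.projectionOnto_apply_of_mem_left _ hy,
        (Submodule.projectionOnto_apply_eq_zero_iff _).2 hz, add_zero]
    have h2 : G.mulVecLin z = 0 := hz
    rw [h1] at this
    have h3 : π (y + z) = y := by
      simp only [π, LinearMap.comp_apply, h1]; rfl
    simp only [LinearMap.comp_apply, h3]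
    rw [Matrix.toLin'_apply', map_add, h2, add_zero]
    simpa using this

lemma L3' {F : Type*} [Field F] {n m : ℕ} (hmn : n ≤ m) (G : Matrix (Fin n) (Fin m) F) :
    ∃ (A : Matrix (Fin n) (Fin m) F) (B : Matrix (Fin n) (Fin n) F), A.rank = n ∧ G = B * A := by
  obtain ⟨A, B, h, h'⟩ := L3 hmn G.transpose
  refine ⟨A.transpose, B.transpose, by rwa [Matrix.rank_transpose], ?_⟩
  rw [← Matrix.transpose_mul, ← h', Matrix.transpose_transpose]

lemma isUnit_det {F : Type*} [Field F] {n : ℕ} (P : Matrix (Fin n) (Fin n) F) (h : P.rank = n) :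
    IsUnit P.det := by
  obtain ⟨Q, hQ⟩ := L2 P 1 h (by simp)
  rw [← Matrix.isUnit_iff_isUnit_det]
  exact IsUnit.of_mul_eq_one_right _ hQ.symm

lemma unit_det {F : Type*} [Field F] {n : ℕ} (Q : (Matrix (Fin n) (Fin n) F)ˣ) :
    IsUnit (Q : Matrix (Fin n) (Fin n) F).det :=
  (Matrix.isUnit_iff_isUnit_det _).1 Q.isUnit

end CapAux

namespace CapAux

abbrev FR (F : Type) [Field F] (n m : ℕ) := {A : Matrix (Fin n) (Fin m) F // A.rank = min n m}

noncomputable instance frFintype (F : Type) [Field F] [Fintype F] (n m : ℕ) : Fintype (FR F n m) :=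
  Fintype.ofFinite _

noncomputable instance glFintype (F : Type) [Field F] [Fintype F] (n : ℕ) :
    Fintype (Matrix (Fin n) (Fin n) F)ˣ :=
  Fintype.ofFinite _

lemma capM_eq (F : Type) [Field F] [Fintype F] (n m T : ℕ) : capacityM F n m T =
    cap (fun (G : Matrix (Fin n) (Fin m) F) (X : Matrix (Fin m) (Fin T) F) => G * X) := by
  unfold capacityM cap
  simp only [Nat.card_eq_fintype_card]

lemma capFM_eq (F : Type) [Field F] [Fintype F] (n m T : ℕ) : capacityFM F n m T =
    cap (fun (G : FR F n m) (X : Matrix (Fin m) (Fin T) F) => G.1 * X) := by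
  unfold capacityFM cap
  congr!

noncomputable def ext {a b : ℕ} {A : Type*} [Zero A] (h : a ≤ b) (f : Fin a → A) : Fin b → A :=
  Function.extend (Fin.castLE h) f 0

lemma ext_cast {a b : ℕ} {A : Type*} [Zero A] (h : a ≤ b) (f : Fin a → A) (i : Fin a) :
    ext h f (Fin.castLE h i) = f i :=
  (Fin.castLE_injective h).extend_apply _ _ _

lemma ineq1 (F : Type) [Field F] [Fintype F] (a b n m T : ℕ) (ha : a ≤ n) (hb : b ≤ m) :
    capacityM F a b T ≤ capacityM F n m T := by
  rw [capM_eq, capM_eq]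
  refine cap_le (S := Unit) (Z := Matrix (Fin n) (Fin m) F) _ _
    (fun _ X => Matrix.of fun i t => ext hb (fun k => X k t) i)
    (fun _ Y => Y.submatrix (Fin.castLE ha) id) (fun _ => ()) id
    (fun G => G.submatrix (Fin.castLE ha) (Fin.castLE hb)) ?_ ?_ ?_
  · rintro ⟨_, b⟩ ⟨_, b'⟩
    refine ⟨fun z => z + (b' - b), add_left_injective _, ?_⟩
    rintro z h
    simp at h
    simp [h]
  · intro c c'
    refine ⟨fun z => z + Matrix.of (ext ha (fun i => ext hb ((c' - c) i))), add_left_injective _, ?_⟩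
    rintro z rfl
    ext i j
    simp [ext_cast]
  · intro G X
    ext i t
    simp only [Matrix.mul_apply, Matrix.submatrix_apply, id]
    refine Fintype.sum_of_injective (Fin.castLE hb) (Fin.castLE_injective hb) _ _ ?_ ?_
    · intro j hj
      simp only [Matrix.of_apply, ext]
      rw [Function.extend_apply' _ _ _ (by simpa only [Set.mem_range] using hj)]
      simp
    · intro j
      simp [ext_cast]

lemma ineq2a (F : Type) [Field F] [Fintype F] (n m T : ℕ) (hmn : m ≤ n) :
    capacityM F n m T ≤ capacityFM F n m T := by
  classical
  rw [capM_eq, capFM_eq]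
  choose A B hA hG using fun G : Matrix (Fin n) (Fin m) F => L3 hmn G
  refine cap_le (S := Matrix (Fin n) (Fin m) F)
    (Z := Matrix (Fin n) (Fin m) F × (Matrix (Fin n) (Fin n) F)ˣ) _ _
    (fun G X => B G * X) (fun _ Y => Y) (fun z => z.1)
    (fun z => ⟨z.2.1 * A z.1, by
      rw [Matrix.rank_mul_eq_right_of_isUnit_det _ _ (unit_det _), hA, min_eq_right hmn]⟩)
    (fun z => z.2.1 * z.1) ?_ ?_ ?_
  · rintro ⟨G, M, hM⟩ ⟨G', M', hM'⟩
    rw [min_eq_right hmn] at hM hM'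
    obtain ⟨R, hR⟩ := L2 _ _ (hA G) (hA G')
    obtain ⟨U, hU⟩ := L2 _ _ hM hM'
    refine ⟨fun z => (Equiv.swap G G' z.1, U * z.2 * R⁻¹), ?_, ?_⟩
    · rintro ⟨x, y⟩ ⟨x', y'⟩ h
      simpa using h
    · rintro ⟨H, Q⟩ h
      simp only [Prod.mk.injEq, Subtype.mk.injEq] at h ⊢
      obtain ⟨rfl, rfl⟩ := h
      refine ⟨by simp, ?_⟩
      rw [Equiv.swap_apply_left, hR, hU]
      simp [Matrix.mul_assoc]
  · intro c c'
    refine ⟨fun z => (z.1 + (z.2⁻¹).1 * (c' - c), z.2), ?_, ?_⟩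
    · rintro ⟨x, y⟩ ⟨x', y'⟩ h
      simp only [Prod.mk.injEq] at h
      obtain ⟨h1, rfl⟩ := h
      simpa using h1
    · rintro ⟨H, Q⟩ rfl
      simp [Matrix.mul_add, ← Matrix.mul_assoc]
  · rintro ⟨G, Q⟩ X
    simp only [Matrix.mul_assoc]
    rw [← Matrix.mul_assoc (A G), ← hG]

lemma ineq2b (F : Type) [Field F] [Fintype F] (n m T : ℕ) (hmn : n ≤ m) :
    capacityM F n m T ≤ capacityFM F n m T := by
  classical
  rw [capM_eq, capFM_eq]
  choose A B hA hG using fun G : Matrix (Fin n) (Fin m) F => L3' hmn G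
  refine cap_le (S := Matrix (Fin n) (Fin m) F)
    (Z := Matrix (Fin n) (Fin m) F × (Matrix (Fin m) (Fin m) F)ˣ) _ _
    (fun _ X => X) (fun G Y => B G * Y) (fun z => z.1)
    (fun z => ⟨A z.1 * z.2.1, by
      rw [Matrix.rank_mul_eq_left_of_isUnit_det _ _ (unit_det _), hA, min_eq_left hmn]⟩)
    (fun z => z.1 * z.2.1) ?_ ?_ ?_
  · rintro ⟨G, M, hM⟩ ⟨G', M', hM'⟩
    rw [min_eq_left hmn] at hM hM'
    obtain ⟨R, hR⟩ := L2' _ _ (hA G) (hA G')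
    obtain ⟨U, hU⟩ := L2' _ _ hM hM'
    refine ⟨fun z => (Equiv.swap G G' z.1, R⁻¹ * z.2 * U), ?_, ?_⟩
    · rintro ⟨x, y⟩ ⟨x', y'⟩ h
      simpa using h
    · rintro ⟨H, Q⟩ h
      simp only [Prod.mk.injEq, Subtype.mk.injEq] at h ⊢
      obtain ⟨rfl, rfl⟩ := h
      refine ⟨by simp, ?_⟩
      rw [Equiv.swap_apply_left, hR, hU]
      simp [← Matrix.mul_assoc]
  · intro c c'
    refine ⟨fun z => (z.1 + (c' - c) * (z.2⁻¹).1, z.2), ?_, ?_⟩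
    · rintro ⟨x, y⟩ ⟨x', y'⟩ h
      simp only [Prod.mk.injEq] at h
      obtain ⟨h1, rfl⟩ := h
      simpa using h1
    · rintro ⟨H, Q⟩ rfl
      simp [Matrix.add_mul, Matrix.mul_assoc]
  · rintro ⟨G, Q⟩ X
    simp only [← Matrix.mul_assoc]
    rw [← hG]

lemma unif_id {A : Type*} : Unif (fun z : A => z) := by
  classical
  intro b b'
  exact ⟨Equiv.swap b b', (Equiv.swap b b').injective, by rintro z rfl; simp⟩

lemma fr_nonempty (F : Type) [Field F] (n m : ℕ) : Nonempty (FR F n m) := by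
  rcases le_total m n with h | h
  · obtain ⟨A, _, hA, _⟩ := L3 h (0 : Matrix (Fin n) (Fin m) F)
    exact ⟨A, by rw [hA, min_eq_right h]⟩
  · obtain ⟨A, _, hA, _⟩ := L3' h (0 : Matrix (Fin n) (Fin m) F)
    exact ⟨A, by rw [hA, min_eq_left h]⟩

lemma ineq3a (F : Type) [Field F] [Fintype F] (n m T : ℕ) (hmn : m ≤ n) :
    capacityFM F n m T ≤ capacityFM F m m T := by
  rw [capFM_eq, capFM_eq]
  have := fr_nonempty F n m
  have := fr_nonempty F m m
  refine cap_le (S := FR F n m) (Z := FR F n m × FR F m m) _ _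
    (fun _ X => X) (fun A Y => A.1 * Y) (fun z => z.1) (fun z => z.2)
    (fun z => ⟨z.1.1 * z.2.1, by
      rw [Matrix.rank_mul_eq_left_of_isUnit_det _ _ (isUnit_det _ (by rw [z.2.2, min_self])), z.1.2]⟩)
    unif_id ?_ ?_
  · rintro ⟨M, hM⟩ ⟨M', hM'⟩
    rw [min_eq_right hmn] at hM hM'
    obtain ⟨U, hU⟩ := L2 _ _ hM hM'
    refine ⟨fun z => (⟨U.1 * z.1.1, by
      rw [Matrix.rank_mul_eq_right_of_isUnit_det _ _ (unit_det _), z.1.2]⟩, z.2), ?_, ?_⟩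
    · rintro ⟨⟨x, _⟩, y⟩ ⟨⟨x', _⟩, y'⟩ h
      simp only [Prod.mk.injEq, Subtype.mk.injEq] at h ⊢
      refine ⟨?_, h.2⟩
      have := congrArg (fun z => (U⁻¹).1 * z) h.1
      simpa [← Matrix.mul_assoc] using this
    · rintro ⟨⟨x, _⟩, y⟩ h
      simp only [Subtype.mk.injEq] at h ⊢
      rw [hU, ← h, Matrix.mul_assoc]
  · rintro ⟨A, P⟩ X
    exact Matrix.mul_assoc _ _ _

lemma ineq3b (F : Type) [Field F] [Fintype F] (n m T : ℕ) (hmn : n ≤ m) :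
    capacityFM F n m T ≤ capacityFM F n n T := by
  rw [capFM_eq, capFM_eq]
  have := fr_nonempty F n m
  have := fr_nonempty F n n
  refine cap_le (S := FR F n m) (Z := FR F n m × FR F n n) _ _
    (fun A X => A.1 * X) (fun _ Y => Y) (fun z => z.1) (fun z => z.2)
    (fun z => ⟨z.2.1 * z.1.1, by
      rw [Matrix.rank_mul_eq_right_of_isUnit_det _ _ (isUnit_det _ (by rw [z.2.2, min_self])), z.1.2]⟩)
    unif_id ?_ ?_
  · rintro ⟨M, hM⟩ ⟨M', hM'⟩
    rw [min_eq_left hmn] at hM hM'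
    obtain ⟨U, hU⟩ := L2' _ _ hM hM'
    refine ⟨fun z => (⟨z.1.1 * U.1, by
      rw [Matrix.rank_mul_eq_left_of_isUnit_det _ _ (unit_det _), z.1.2]⟩, z.2), ?_, ?_⟩
    · rintro ⟨⟨x, _⟩, y⟩ ⟨⟨x', _⟩, y'⟩ h
      simp only [Prod.mk.injEq, Subtype.mk.injEq] at h ⊢
      refine ⟨?_, h.2⟩
      have := congrArg (fun z => z * (U⁻¹).1) h.1
      simpa [Matrix.mul_assoc] using this
    · rintro ⟨⟨x, _⟩, y⟩ h
      simp only [Subtype.mk.injEq] at h ⊢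
      rw [hU, ← h, Matrix.mul_assoc]
  · rintro ⟨A, P⟩ X
    exact Matrix.mul_assoc _ _ _

end CapAux

/-- Sandwich bounds relating the capacities of the uniform-matrix channel and the
uniform full-rank-matrix channel, with `h = min m n`. -/
theorem capacity_sandwich (F : Type) [Field F] [Fintype F] (m n T : ℕ)
    (hm : 0 < m) (hn : 0 < n) (hT : 0 < T) :
    capacityM F (min m n) (min m n) T ≤ capacityM F n m T ∧
    capacityM F n m T ≤ capacityFM F n m T ∧
    capacityFM F n m T ≤ capacityFM F (min m n) (min m n) T := by
  refine ⟨CapAux.ineq1 F _ _ n m T (min_le_right _ _) (min_le_left _ _), ?_⟩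
  rcases le_total m n with h | h
  · rw [min_eq_left h]
    exact ⟨CapAux.ineq2a F n m T h, CapAux.ineq3a F n m T h⟩
  · rw [min_eq_right h]
    exact ⟨CapAux.ineq2b F n m T h, CapAux.ineq3b F n m T h⟩
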